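/- Two-sided return gap bound: Let M = (S, A, T, r, μ₀, γ) and M̃ = (S, A, T̃, r, μ₀, γ) be two finite discounted MDPs differing only in their dynamics, and let ũ : S × A → ℝ be an admissible error estimator, i.e. for every stationary stochastic policy π and every (s, a) ∈ S × A, |E_{s'∼T̃(s,a)}[V_M^π(s')] − E_{s'∼T(s,a)}[V_M^π(s')]| ≤ ũ(s, a). Set λ := γ and define the policy-level uncertainty ε_ũ(π) := Ē_{(s,a)∼ρ_{T̃}^π}[ũ(s, a)]. Then for every stationary stochastic policy π, |η_M(π) − η_M̃(π)| ≤ λ · ε_ũ(π). -/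

import Mathlib

open scoped BigOperators

/-- Expectation of a real-valued function under a `PMF` on a finite type. -/
noncomputable def pmfExp {X : Type*} [Fintype X] (d : PMF X) (f : X → ℝ) : ℝ :=
  ∑ x, (d x).toReal * f x

/-- Initial state–action distribution: `s ∼ μ`, `a ∼ π s`. -/
noncomputable def initSA {S A : Type*} (π : S → PMF A) (μ : PMF S) : PMF (S × A) :=
  μ.bind fun s => (π s).map fun a => (s, a)

/-- One step of the state–action Markov chain induced by dynamics `T` and policy `π`. -/
noncomputable def stepSA {S A : Type*} (T : S → A → PMF S) (π : S → PMF A)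
    (d : PMF (S × A)) : PMF (S × A) :=
  d.bind fun sa => (T sa.1 sa.2).bind fun s' => (π s').map fun a' => (s', a')

/-- Distribution of the time-`t` state–action pair of the chain started from `μ`. -/
noncomputable def saDist {S A : Type*} (T : S → A → PMF S) (π : S → PMF A)
    (μ : PMF S) : ℕ → PMF (S × A)
  | 0 => initSA π μ
  | (t + 1) => stepSA T π (saDist T π μ t)

/-- Unnormalized discounted occupancy expectation
`Ē_{(s,a)∼ρ_T^π}[f] = Σ_t γ^t E[f(s_t,a_t)]`, chain started from `μ`. -/
noncomputable def occExp {S A : Type*} [Fintype S] [Fintype A]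
    (T : S → A → PMF S) (π : S → PMF A) (μ : PMF S) (γ : ℝ) (f : S × A → ℝ) : ℝ :=
  ∑' t : ℕ, γ ^ t * pmfExp (saDist T π μ t) f

/-- Value function `V_M^π(s)` of the MDP with dynamics `T`, reward `r`, discount `γ`. -/
noncomputable def valueFun {S A : Type*} [Fintype S] [Fintype A]
    (T : S → A → PMF S) (π : S → PMF A) (r : S × A → ℝ) (γ : ℝ) (s : S) : ℝ :=
  occExp T π (PMF.pure s) γ r

/-- Expected return `η_M(π) = E_{s∼μ₀}[V_M^π(s)]`. -/
noncomputable def expReturn {S A : Type*} [Fintype S] [Fintype A]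
    (T : S → A → PMF S) (π : S → PMF A) (r : S × A → ℝ) (γ : ℝ) (μ : PMF S) : ℝ :=
  ∑ s, (μ s).toReal * valueFun T π r γ s

/-- Model-error gap `G_{M̃}^π(s,a) = E_{s'∼T̃(s,a)}[V_M^π(s')] − E_{s'∼T(s,a)}[V_M^π(s')]`,
where `T` is the true dynamics and `T'` the model dynamics. -/
noncomputable def Ggap {S A : Type*} [Fintype S] [Fintype A]
    (T T' : S → A → PMF S) (π : S → PMF A) (r : S × A → ℝ) (γ : ℝ) (sa : S × A) : ℝ :=
  (∑ s', ((T' sa.1 sa.2) s').toReal * valueFun T π r γ s') -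
    (∑ s', ((T sa.1 sa.2) s').toReal * valueFun T π r γ s')

section PMFExpectation

variable {X Y : Type*} [Fintype X] [Fintype Y]

theorem sum_toReal_pmf (d : PMF X) : ∑ x, (d x).toReal = 1 := by
  rw [← ENNReal.toReal_sum fun x _ => d.apply_ne_top x, ← tsum_fintype (L := .unconditional X),
    d.tsum_coe, ENNReal.toReal_one]

theorem pmfExp_bind (d : PMF X) (k : X → PMF Y) (f : Y → ℝ) :
    pmfExp (d.bind k) f = pmfExp d fun x => pmfExp (k x) f := by
  have hbind (y : Y) : ((d.bind k) y).toReal = ∑ x, (d x).toReal * (k x y).toReal := by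
    rw [PMF.bind_apply, tsum_fintype, ENNReal.toReal_sum fun x _ =>
      ENNReal.mul_ne_top (d.apply_ne_top x) ((k x).apply_ne_top y)]
    simp only [ENNReal.toReal_mul]
  simp only [pmfExp, hbind, Finset.sum_mul, Finset.mul_sum, mul_assoc]
  exact Finset.sum_comm

theorem pmfExp_pure (x : X) (f : X → ℝ) : pmfExp (PMF.pure x) f = f x := by
  classical
  simp [pmfExp, PMF.pure_apply, apply_ite ENNReal.toReal]

theorem pmfExp_map (d : PMF X) (g : X → Y) (f : Y → ℝ) :
    pmfExp (d.map g) f = pmfExp d fun x => f (g x) := by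
  simp [← PMF.bind_pure_comp, pmfExp_bind, pmfExp_pure]

theorem pmfExp_const (d : PMF X) (c : ℝ) : pmfExp d (fun _ => c) = c := by
  rw [pmfExp, ← Finset.sum_mul, sum_toReal_pmf, one_mul]

theorem pmfExp_sub (d : PMF X) (f g : X → ℝ) :
    pmfExp d (fun x => f x - g x) = pmfExp d f - pmfExp d g := by
  simp only [pmfExp, mul_sub, Finset.sum_sub_distrib]

theorem pmfExp_const_mul (d : PMF X) (c : ℝ) (f : X → ℝ) :
    pmfExp d (fun x => c * f x) = c * pmfExp d f := by
  simp only [pmfExp, Finset.mul_sum, mul_left_comm]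

theorem pmfExp_mono (d : PMF X) {f g : X → ℝ} (h : ∀ x, f x ≤ g x) :
    pmfExp d f ≤ pmfExp d g :=
  Finset.sum_le_sum fun x _ => mul_le_mul_of_nonneg_left (h x) ENNReal.toReal_nonneg

theorem abs_pmfExp_le (d : PMF X) (f : X → ℝ) : |pmfExp d f| ≤ pmfExp d fun x => |f x| := by
  refine (Finset.abs_sum_le_sum_abs _ _).trans_eq (Finset.sum_congr rfl fun x _ => ?_)
  rw [abs_mul, abs_of_nonneg ENNReal.toReal_nonneg]

theorem abs_pmfExp_le_sum_abs (d : PMF X) (f : X → ℝ) : |pmfExp d f| ≤ ∑ x, |f x| := by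
  refine (abs_pmfExp_le d f).trans <| (pmfExp_mono d fun x => ?_).trans_eq (pmfExp_const d _)
  exact Finset.single_le_sum (f := fun x => |f x|) (fun _ _ => abs_nonneg _) (Finset.mem_univ x)

theorem summable_pow_mul_pmfExp {γ : ℝ} (hγ0 : 0 ≤ γ) (hγ1 : γ < 1) (d : ℕ → PMF X)
    (f : X → ℝ) : Summable fun t => γ ^ t * pmfExp (d t) f := by
  refine Summable.of_norm_bounded
    ((summable_geometric_of_lt_one hγ0 hγ1).mul_right (∑ x, |f x|)) fun t => ?_
  rw [Real.norm_eq_abs, abs_mul, abs_of_nonneg (pow_nonneg hγ0 t)]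
  exact mul_le_mul_of_nonneg_left (abs_pmfExp_le_sum_abs _ _) (pow_nonneg hγ0 t)

end PMFExpectation

section StateActionChain

variable {S A : Type*}

theorem stepSA_eq_initSA (T : S → A → PMF S) (π : S → PMF A) (d : PMF (S × A)) :
    stepSA T π d = initSA π (d.bind fun sa => T sa.1 sa.2) := by
  simp only [stepSA, initSA, PMF.bind_bind]

theorem saDist_succ_eq_saDist (T : S → A → PMF S) (π : S → PMF A) (μ : PMF S) (t : ℕ) :
    saDist T π μ (t + 1) = saDist T π ((initSA π μ).bind fun sa => T sa.1 sa.2) t := by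
  induction t with
  | zero => exact stepSA_eq_initSA T π _
  | succ t ih => exact congrArg (stepSA T π) ih

theorem saDist_eq_bind_pure (T : S → A → PMF S) (π : S → PMF A) (μ : PMF S) (t : ℕ) :
    saDist T π μ t = μ.bind fun s => saDist T π (PMF.pure s) t := by
  induction t with
  | zero => simp [saDist, initSA]
  | succ t ih =>
    simp only [saDist]
    rw [ih]
    simp only [stepSA, PMF.bind_bind]

/-- Every time-`t` distribution is generated by drawing an action from the policy. -/
theorem exists_saDist_eq_initSA (T : S → A → PMF S) (π : S → PMF A) (μ : PMF S) (t : ℕ) :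
    ∃ ν, saDist T π μ t = initSA π ν := by
  cases t with
  | zero => exact ⟨μ, rfl⟩
  | succ t => exact ⟨_, stepSA_eq_initSA T π _⟩

variable [Fintype S] [Fintype A]

theorem pmfExp_initSA (π : S → PMF A) (μ : PMF S) (f : S × A → ℝ) :
    pmfExp (initSA π μ) f = pmfExp μ fun s => pmfExp (π s) fun a => f (s, a) := by
  simp only [initSA, pmfExp_bind, pmfExp_map]

theorem pmfExp_initSA_fst (π : S → PMF A) (μ : PMF S) (v : S → ℝ) :
    pmfExp (initSA π μ) (fun sa => v sa.1) = pmfExp μ v := by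
  simp only [pmfExp_initSA, pmfExp_const]

theorem pmfExp_saDist_succ_fst (T : S → A → PMF S) (π : S → PMF A) (μ : PMF S) (t : ℕ)
    (v : S → ℝ) :
    pmfExp (saDist T π μ (t + 1)) (fun sa => v sa.1) =
      pmfExp (saDist T π μ t) fun sa => pmfExp (T sa.1 sa.2) v := by
  rw [saDist, stepSA_eq_initSA, pmfExp_initSA_fst, pmfExp_bind]

theorem occExp_eq_pmfExp_pure {γ : ℝ} (hγ0 : 0 ≤ γ) (hγ1 : γ < 1) (T : S → A → PMF S)
    (π : S → PMF A) (μ : PMF S) (f : S × A → ℝ) :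
    occExp T π μ γ f = pmfExp μ fun s => occExp T π (PMF.pure s) γ f := by
  have hterm (t : ℕ) : γ ^ t * pmfExp (saDist T π μ t) f =
      ∑ s, (μ s).toReal * (γ ^ t * pmfExp (saDist T π (PMF.pure s) t) f) := by
    rw [saDist_eq_bind_pure, pmfExp_bind, ← pmfExp_const_mul, pmfExp]
  simp only [occExp, hterm]
  rw [Summable.tsum_finsetSum fun s _ =>
    (summable_pow_mul_pmfExp hγ0 hγ1 (saDist T π (PMF.pure s)) f).mul_left _]
  simp only [tsum_mul_left, pmfExp]

theorem occExp_eq_add_mul {γ : ℝ} (hγ0 : 0 ≤ γ) (hγ1 : γ < 1) (T : S → A → PMF S)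
    (π : S → PMF A) (μ : PMF S) (f : S × A → ℝ) :
    occExp T π μ γ f = pmfExp (initSA π μ) f +
      γ * occExp T π ((initSA π μ).bind fun sa => T sa.1 sa.2) γ f := by
  rw [occExp, (summable_pow_mul_pmfExp hγ0 hγ1 (saDist T π μ) f).tsum_eq_zero_add]
  simp only [saDist_succ_eq_saDist, pow_succ', mul_assoc, tsum_mul_left, occExp, pow_zero, one_mul]
  rfl

theorem expReturn_eq_occExp {γ : ℝ} (hγ0 : 0 ≤ γ) (hγ1 : γ < 1) (T : S → A → PMF S)
    (π : S → PMF A) (r : S × A → ℝ) (μ : PMF S) :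
    expReturn T π r γ μ = occExp T π μ γ r :=
  (occExp_eq_pmfExp_pure hγ0 hγ1 T π μ r).symm

/-- The Bellman equation, averaged over an initial state distribution. -/
theorem pmfExp_valueFun {γ : ℝ} (hγ0 : 0 ≤ γ) (hγ1 : γ < 1) (T : S → A → PMF S)
    (π : S → PMF A) (r : S × A → ℝ) (μ : PMF S) :
    pmfExp μ (valueFun T π r γ) = pmfExp (initSA π μ) r +
      γ * pmfExp (initSA π μ) fun sa => pmfExp (T sa.1 sa.2) (valueFun T π r γ) := by
  have h (ν : PMF S) : pmfExp ν (valueFun T π r γ) = occExp T π ν γ r :=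
    expReturn_eq_occExp hγ0 hγ1 T π r ν
  rw [← pmfExp_bind, h, h, occExp_eq_add_mul hγ0 hγ1]

theorem pmfExp_saDist_Ggap {γ : ℝ} (hγ0 : 0 ≤ γ) (hγ1 : γ < 1) (T T' : S → A → PMF S)
    (π : S → PMF A) (r : S × A → ℝ) (μ : PMF S) (t : ℕ) :
    γ * pmfExp (saDist T' π μ t) (Ggap T T' π r γ) =
      pmfExp (saDist T' π μ t) r +
      γ * pmfExp (saDist T' π μ (t + 1)) (fun sa => valueFun T π r γ sa.1) -
      pmfExp (saDist T' π μ t) (fun sa => valueFun T π r γ sa.1) := by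
  have hG : pmfExp (saDist T' π μ t) (Ggap T T' π r γ) =
      pmfExp (saDist T' π μ t) (fun sa => pmfExp (T' sa.1 sa.2) (valueFun T π r γ)) -
      pmfExp (saDist T' π μ t) fun sa => pmfExp (T sa.1 sa.2) (valueFun T π r γ) :=
    pmfExp_sub _ _ _
  rw [hG, pmfExp_saDist_succ_fst]
  obtain ⟨ν, hν⟩ := exists_saDist_eq_initSA T' π μ t
  rw [hν, pmfExp_initSA_fst, pmfExp_valueFun hγ0 hγ1]
  ring

/-- The simulation lemma: the return gap is the discounted occupancy of the model-error gap. -/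
theorem expReturn_sub_expReturn {γ : ℝ} (hγ0 : 0 ≤ γ) (hγ1 : γ < 1) (T T' : S → A → PMF S)
    (π : S → PMF A) (r : S × A → ℝ) (μ : PMF S) :
    expReturn T' π r γ μ - expReturn T π r γ μ = γ * occExp T' π μ γ (Ggap T T' π r γ) := by
  have hr := summable_pow_mul_pmfExp hγ0 hγ1 (saDist T' π μ) r
  have hv := summable_pow_mul_pmfExp hγ0 hγ1 (saDist T' π μ) fun sa => valueFun T π r γ sa.1
  have hv' := (summable_nat_add_iff 1).mpr hv
  have hterm (t : ℕ) : γ * (γ ^ t * pmfExp (saDist T' π μ t) (Ggap T T' π r γ)) =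
      γ ^ t * pmfExp (saDist T' π μ t) r +
      γ ^ (t + 1) * pmfExp (saDist T' π μ (t + 1)) (fun sa => valueFun T π r γ sa.1) -
      γ ^ t * pmfExp (saDist T' π μ t) (fun sa => valueFun T π r γ sa.1) := by
    linear_combination γ ^ t * pmfExp_saDist_Ggap hγ0 hγ1 T T' π r μ t
  have hη : expReturn T π r γ μ =
      pmfExp (saDist T' π μ 0) fun sa => valueFun T π r γ sa.1 :=
    (pmfExp_initSA_fst π μ (valueFun T π r γ)).symm
  rw [expReturn_eq_occExp hγ0 hγ1 T', hη, occExp, occExp, ← tsum_mul_left, tsum_congr hterm,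
    (hr.add hv').tsum_sub hv, hr.tsum_add hv', hv.tsum_eq_zero_add]
  ring

theorem abs_occExp_le {γ : ℝ} (hγ0 : 0 ≤ γ) (hγ1 : γ < 1) (T : S → A → PMF S)
    (π : S → PMF A) (μ : PMF S) {f g : S × A → ℝ} (h : ∀ sa, |f sa| ≤ g sa) :
    |occExp T π μ γ f| ≤ occExp T π μ γ g := by
  refine tsum_of_norm_bounded (f := fun t => γ ^ t * pmfExp (saDist T π μ t) f)
    (summable_pow_mul_pmfExp hγ0 hγ1 (saDist T π μ) g).hasSum fun t => ?_
  rw [Real.norm_eq_abs, abs_mul, abs_of_nonneg (pow_nonneg hγ0 t)]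
  exact mul_le_mul_of_nonneg_left ((abs_pmfExp_le _ _).trans (pmfExp_mono _ h)) (pow_nonneg hγ0 t)

end StateActionChain

/-- **Two-sided return gap bound.**
If `ũ` is an admissible error estimator, then with `λ := γ` and
`ε_ũ(π) := Ē_{(s,a)∼ρ_{T̃}^π}[ũ(s,a)]`, for every policy `π`,
`|η_M(π) − η_{M̃}(π)| ≤ λ·ε_ũ(π)`. -/
theorem two_sided_return_gap_bound
    {S A : Type*} [Fintype S] [Fintype A] [Nonempty S] [Nonempty A]
    (T T' : S → A → PMF S) (r : S × A → ℝ) (μ₀ : PMF S) (γ : ℝ)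
    (hγ0 : 0 ≤ γ) (hγ1 : γ < 1) (u : S × A → ℝ)
    (hu : ∀ (π : S → PMF A) (s : S) (a : A),
      |(∑ s', ((T' s a) s').toReal * valueFun T π r γ s') -
        (∑ s', ((T s a) s').toReal * valueFun T π r γ s')| ≤ u (s, a)) :
    ∀ π : S → PMF A,
      |expReturn T π r γ μ₀ - expReturn T' π r γ μ₀| ≤ γ * occExp T' π μ₀ γ u := by
  intro π
  rw [abs_sub_comm, expReturn_sub_expReturn hγ0 hγ1, abs_mul, abs_of_nonneg hγ0]
  exact mul_le_mul_of_nonneg_left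
    (abs_occExp_le hγ0 hγ1 T' π μ₀ fun sa => hu π sa.1 sa.2) hγ0
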